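/- arXiv:2401.00969 — 13 statements merged into one kernel-verified Lean document; each statement's English description precedes it below -/
import Mathlib

section
/- Suppose χ and ξ are continuous g-Bessel families and that there exist constants α₁, α₂ > 0 such that for every f ∈ H and every measurable set J ⊆ 𝔄 there exist w, w' ∈ L²(𝔄, μ; K) with ‖w‖_{L²} ≤ α₁‖f‖ and ‖w'‖_{L²} ≤ α₂‖f‖, the maps ς ↦ χ_ς*(w(ς)) (on J) and ς ↦ ξ_ς*(w'(ς)) (on 𝔄∖J) are Bochner integrable, and L f = ∫_J χ_ς*(w(ς)) dμ(ς) + ∫_{𝔄∖J} ξ_ς*(w'(ς)) dμ(ς). Then for every measurable set J ⊆ 𝔄 and every f ∈ H one has ∫_J ‖χ_ς f‖² dμ(ς) + ∫_{𝔄∖J} ‖ξ_ς f‖² dμ(ς) ≥ (1/(α₁+α₂)²)‖L* f‖²; in particular χ and ξ are woven continuous L-g-frames. -/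
open MeasureTheory

lemma aux_norm_sq {𝔄 : Type*} [MeasurableSpace 𝔄] (μ : Measure 𝔄) {K : Type*}
    [NormedAddCommGroup K] [InnerProductSpace ℂ K] (w : Lp K 2 μ) :
    ∫ ς, ‖w ς‖ ^ 2 ∂μ = ‖w‖ ^ 2 := by
  have h := L2.inner_def (𝕜 := ℂ) w w
  simp only [inner_self_eq_norm_sq_to_K] at h
  have h2 : (((∫ ς, ‖w ς‖ ^ 2 ∂μ : ℝ)) : ℂ) = ((‖w‖ ^ 2 : ℝ) : ℂ) := by
    rw [← integral_complex_ofReal]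
    push_cast
    exact h.symm
  exact_mod_cast h2

lemma aux_cs {𝔄 : Type*} [MeasurableSpace 𝔄] (μ : Measure 𝔄)
    {H K : Type*}
    [NormedAddCommGroup H] [InnerProductSpace ℂ H] [CompleteSpace H]
    [NormedAddCommGroup K] [InnerProductSpace ℂ K] [CompleteSpace K]
    (T : 𝔄 → (H →L[ℂ] K)) (f : H) (hT : Integrable (fun ς => ‖T ς f‖ ^ 2) μ)
    (w : Lp K 2 μ) (J : Set 𝔄)
    (hi : IntegrableOn (fun ς => ContinuousLinearMap.adjoint (T ς) (w ς)) J μ) :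
    ‖inner ℂ f (∫ ς in J, ContinuousLinearMap.adjoint (T ς) (w ς) ∂μ)‖ ≤
      √(∫ ς in J, ‖T ς f‖ ^ 2 ∂μ) * ‖w‖ := by
  have hTm : AEStronglyMeasurable (fun ς => ‖T ς f‖) μ := by
    have := (Real.continuous_sqrt.comp_aestronglyMeasurable hT.1)
    simpa [Real.sqrt_sq] using this
  have hTL : MemLp (fun ς => ‖T ς f‖) 2 (μ.restrict J) :=
    ((memLp_two_iff_integrable_sq hTm).2 hT).restrict J
  have hwL0 : MemLp (fun ς => ‖w ς‖) 2 μ := (Lp.memLp w).norm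
  have hwL : MemLp (fun ς => ‖w ς‖) 2 (μ.restrict J) := hwL0.restrict J
  have hprod : Integrable (fun ς => ‖T ς f‖ * ‖w ς‖) (μ.restrict J) := hTL.integrable_mul hwL
  rw [← integral_inner hi]
  have h1 : ‖∫ ς in J, inner ℂ f (ContinuousLinearMap.adjoint (T ς) (w ς)) ∂μ‖ ≤
      ∫ ς in J, ‖T ς f‖ * ‖w ς‖ ∂μ := by
    refine norm_integral_le_of_norm_le hprod (Filter.Eventually.of_forall fun ς => ?_)
    rw [ContinuousLinearMap.adjoint_inner_right]
    exact norm_inner_le_norm _ _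
  have h2 : ∫ ς in J, ‖T ς f‖ * ‖w ς‖ ∂μ ≤
      √(∫ ς in J, ‖T ς f‖ ^ 2 ∂μ) * √(∫ ς in J, ‖w ς‖ ^ 2 ∂μ) := by
    have := integral_mul_le_Lp_mul_Lq_of_nonneg (μ := μ.restrict J) Real.HolderConjugate.two_two
      (f := fun ς => ‖T ς f‖) (g := fun ς => ‖w ς‖)
      (Filter.Eventually.of_forall fun _ => norm_nonneg _)
      (Filter.Eventually.of_forall fun _ => norm_nonneg _) (by simpa using hTL) (by simpa using hwL)
    simpa [Real.sqrt_eq_rpow] using this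
  have h3 : √(∫ ς in J, ‖w ς‖ ^ 2 ∂μ) ≤ ‖w‖ := by
    rw [Real.sqrt_le_left (norm_nonneg _), ← aux_norm_sq]
    exact setIntegral_le_integral hwL0.integrable_sq
      (Filter.Eventually.of_forall fun _ => by positivity)
  exact h1.trans (h2.trans (mul_le_mul_of_nonneg_left h3 (Real.sqrt_nonneg _)))

/-- Woven continuous atomic g-systems are woven continuous L-g-frames (lower bound). -/
theorem stmt_0
    {𝔄 : Type*} [MeasurableSpace 𝔄] (μ : Measure 𝔄)
    {H K : Type*}
    [NormedAddCommGroup H] [InnerProductSpace ℂ H] [CompleteSpace H]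
    [NormedAddCommGroup K] [InnerProductSpace ℂ K] [CompleteSpace K]
    (L : H →L[ℂ] H) (χ ξ : 𝔄 → (H →L[ℂ] K))
    (B B' : ℝ) (hB : 0 < B) (hB' : 0 < B')
    (hχint : ∀ f : H, Integrable (fun ς => ‖χ ς f‖ ^ 2) μ)
    (hχ : ∀ f : H, ∫ ς, ‖χ ς f‖ ^ 2 ∂μ ≤ B * ‖f‖ ^ 2)
    (hξint : ∀ f : H, Integrable (fun ς => ‖ξ ς f‖ ^ 2) μ)
    (hξ : ∀ f : H, ∫ ς, ‖ξ ς f‖ ^ 2 ∂μ ≤ B' * ‖f‖ ^ 2)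
    (α₁ α₂ : ℝ) (hα₁ : 0 < α₁) (hα₂ : 0 < α₂)
    (hatomic : ∀ (f : H) (J : Set 𝔄), MeasurableSet J →
      ∃ w w' : Lp K 2 μ,
        ‖w‖ ≤ α₁ * ‖f‖ ∧ ‖w'‖ ≤ α₂ * ‖f‖ ∧
        IntegrableOn (fun ς => ContinuousLinearMap.adjoint (χ ς) (w ς)) J μ ∧
        IntegrableOn (fun ς => ContinuousLinearMap.adjoint (ξ ς) (w' ς)) Jᶜ μ ∧
        L f = (∫ ς in J, ContinuousLinearMap.adjoint (χ ς) (w ς) ∂μ) +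
              ∫ ς in Jᶜ, ContinuousLinearMap.adjoint (ξ ς) (w' ς) ∂μ) :
    ∀ (J : Set 𝔄), MeasurableSet J → ∀ f : H,
      (1 / (α₁ + α₂) ^ 2) * ‖ContinuousLinearMap.adjoint L f‖ ^ 2 ≤
        (∫ ς in J, ‖χ ς f‖ ^ 2 ∂μ) + ∫ ς in Jᶜ, ‖ξ ς f‖ ^ 2 ∂μ := by
  intro J hJ f
  set g := ContinuousLinearMap.adjoint L f with hg
  obtain ⟨w, w', hw, hw', hi, hi', hL⟩ := hatomic g J hJ
  have e1 := aux_cs μ χ f (hχint f) w J hi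
  have e2 := aux_cs μ ξ f (hξint f) w' Jᶜ hi'
  set a := ∫ ς in J, ‖χ ς f‖ ^ 2 ∂μ with ha
  set b := ∫ ς in Jᶜ, ‖ξ ς f‖ ^ 2 ∂μ with hb
  have ha0 : 0 ≤ a := integral_nonneg fun _ => by positivity
  have hb0 : 0 ≤ b := integral_nonneg fun _ => by positivity
  have h1 : ‖g‖ ^ 2 ≤ √(a + b) * ((α₁ + α₂) * ‖g‖) := by
    have h : ‖inner ℂ f (L g)‖ = ‖g‖ ^ 2 := by
      rw [← ContinuousLinearMap.adjoint_inner_left, ← hg, inner_self_eq_norm_sq_to_K]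
      simp
    rw [← h, hL, inner_add_right]
    have p1 : √a * ‖w‖ ≤ √(a + b) * (α₁ * ‖g‖) :=
      mul_le_mul (Real.sqrt_le_sqrt (by linarith)) hw (norm_nonneg _) (Real.sqrt_nonneg _)
    have p2 : √b * ‖w'‖ ≤ √(a + b) * (α₂ * ‖g‖) :=
      mul_le_mul (Real.sqrt_le_sqrt (by linarith)) hw' (norm_nonneg _) (Real.sqrt_nonneg _)
    refine (norm_add_le _ _).trans ?_
    linarith
  have hs := Real.sq_sqrt (add_nonneg ha0 hb0)
  have h2 : ‖g‖ ≤ √(a + b) * (α₁ + α₂) := by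
    rcases (norm_nonneg g).eq_or_lt with h0 | h0
    · rw [← h0]; positivity
    · refine le_of_mul_le_mul_right ?_ h0
      linarith
  have h3 : ‖g‖ ^ 2 ≤ (a + b) * (α₁ + α₂) ^ 2 := by
    rw [← hs, ← mul_pow]
    exact pow_le_pow_left₀ (norm_nonneg _) h2 2
  rw [one_div, inv_mul_le_iff₀ (by positivity)]
  linarith
end

section
/- Let χ and ξ be continuous g-Bessel families with bounds B and B' respectively, and assume that for every f ∈ H the map ς ↦ ξ_ς*(χ_ς f) is Bochner integrable. Then for every f ∈ H, ‖∫_𝔄 ξ_ς*(χ_ς f) dμ(ς)‖ ≤ √(B B') ‖f‖. -/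
open MeasureTheory

/-- The mixed frame operator of two continuous g-Bessel families is bounded by √(BB'). -/
theorem stmt_1
    {𝔄 : Type*} [MeasurableSpace 𝔄] (μ : Measure 𝔄)
    {H K : Type*}
    [NormedAddCommGroup H] [InnerProductSpace ℂ H] [CompleteSpace H]
    [NormedAddCommGroup K] [InnerProductSpace ℂ K] [CompleteSpace K]
    (χ ξ : 𝔄 → (H →L[ℂ] K))
    (B B' : ℝ) (hB : 0 < B) (hB' : 0 < B')
    (hχint : ∀ f : H, Integrable (fun ς => ‖χ ς f‖ ^ 2) μ)
    (hχ : ∀ f : H, ∫ ς, ‖χ ς f‖ ^ 2 ∂μ ≤ B * ‖f‖ ^ 2)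
    (hξint : ∀ f : H, Integrable (fun ς => ‖ξ ς f‖ ^ 2) μ)
    (hξ : ∀ f : H, ∫ ς, ‖ξ ς f‖ ^ 2 ∂μ ≤ B' * ‖f‖ ^ 2)
    (hint : ∀ f : H, Integrable (fun ς => ContinuousLinearMap.adjoint (ξ ς) (χ ς f)) μ) :
    ∀ f : H, ‖∫ ς, ContinuousLinearMap.adjoint (ξ ς) (χ ς f) ∂μ‖ ≤ Real.sqrt (B * B') * ‖f‖ := by
  intro f
  set v := ∫ ς, ContinuousLinearMap.adjoint (ξ ς) (χ ς f) ∂μ with hv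
  by_cases hv0 : v = 0
  · rw [hv0, norm_zero]; positivity
  by_cases hf0 : f = 0
  · exfalso; apply hv0; rw [hv, hf0]; simp
  have hvp : 0 < ‖v‖ := norm_pos_iff.mpr hv0
  have hfp : 0 < ‖f‖ := norm_pos_iff.mpr hf0
  have hr : 0 < Real.sqrt B := Real.sqrt_pos.mpr hB
  have hs : 0 < Real.sqrt B' := Real.sqrt_pos.mpr hB'
  have hr2 : Real.sqrt B ^ 2 = B := Real.sq_sqrt hB.le
  have hs2 : Real.sqrt B' ^ 2 = B' := Real.sq_sqrt hB'.le
  rw [Real.sqrt_mul hB.le]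
  generalize Real.sqrt B = r at *
  generalize Real.sqrt B' = s at *
  obtain ⟨t, ht⟩ : ∃ t, t = r * ‖f‖ / (s * ‖v‖) := ⟨_, rfl⟩
  have htp : 0 < t := by rw [ht]; positivity
  have h1 : ‖v‖ ^ 2 ≤
      ∫ ς, (t / 2 * ‖ξ ς v‖ ^ 2 + t⁻¹ / 2 * ‖χ ς f‖ ^ 2) ∂μ := by
    have e : inner ℂ v v = ∫ ς, inner ℂ v (ContinuousLinearMap.adjoint (ξ ς) (χ ς f)) ∂μ := by
      rw [integral_inner (hint f) v]
    have e2 : ‖v‖ ^ 2 = ‖inner ℂ v v‖ := by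
      rw [inner_self_eq_norm_sq_to_K]; simp
    rw [e2, e]
    refine norm_integral_le_of_norm_le
      (((hξint v).const_mul _).add ((hχint f).const_mul _)) (Filter.Eventually.of_forall ?_)
    intro ς
    simp only [ContinuousLinearMap.adjoint_inner_right]
    refine (norm_inner_le_norm _ _).trans ?_
    generalize ‖ξ ς v‖ = x
    generalize ‖χ ς f‖ = y
    have : t / 2 * x ^ 2 + t⁻¹ / 2 * y ^ 2 - x * y = t⁻¹ / 2 * (t * x - y) ^ 2 := by
      field_simp
      ring
    have h0 : 0 ≤ t⁻¹ / 2 * (t * x - y) ^ 2 := by positivity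
    linarith
  rw [integral_add ((hξint v).const_mul _) ((hχint f).const_mul _),
    integral_const_mul, integral_const_mul] at h1
  have h2 := mul_le_mul_of_nonneg_left (hξ v) (by positivity : 0 ≤ t / 2)
  have h3 := mul_le_mul_of_nonneg_left (hχ f) (by positivity : 0 ≤ t⁻¹ / 2)
  have h4 : t / 2 * (B' * ‖v‖ ^ 2) + t⁻¹ / 2 * (B * ‖f‖ ^ 2) = r * s * ‖f‖ * ‖v‖ := by
    rw [← hr2, ← hs2, ht]
    field_simp
    ring
  have h5 : ‖v‖ * ‖v‖ ≤ r * s * ‖f‖ * ‖v‖ := by nlinarith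
  exact le_of_mul_le_mul_right h5 hvp
end

section
/- Let χ and ξ be continuous g-Bessel families, with ξ having Bessel bound B, and assume that for every f ∈ H the map ς ↦ ξ_ς*(χ_ς f) is Bochner integrable. If there exists γ > 0 such that ‖∫_𝔄 ξ_ς*(χ_ς f) dμ(ς)‖ ≥ γ‖L* f‖ for all f ∈ H, then (γ²/B)‖L* f‖² ≤ ∫_𝔄 ‖χ_ς f‖² dμ(ς) for all f ∈ H; in particular χ is a continuous L-g-frame. -/
open MeasureTheory

/-- If the mixed frame operator of two g-Bessel families dominates γ‖L*f‖, then χ is a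
continuous L-g-frame with lower bound γ²/B, where B is the Bessel bound of ξ. -/
theorem stmt_3
    {𝔄 : Type*} [MeasurableSpace 𝔄] (μ : Measure 𝔄)
    {H K : Type*}
    [NormedAddCommGroup H] [InnerProductSpace ℂ H] [CompleteSpace H]
    [NormedAddCommGroup K] [InnerProductSpace ℂ K] [CompleteSpace K]
    (L : H →L[ℂ] H) (χ ξ : 𝔄 → (H →L[ℂ] K))
    (Bχ B : ℝ) (hBχ : 0 < Bχ) (hB : 0 < B)
    (hχint : ∀ f : H, Integrable (fun ς => ‖χ ς f‖ ^ 2) μ)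
    (hχ : ∀ f : H, ∫ ς, ‖χ ς f‖ ^ 2 ∂μ ≤ Bχ * ‖f‖ ^ 2)
    (hξint : ∀ f : H, Integrable (fun ς => ‖ξ ς f‖ ^ 2) μ)
    (hξ : ∀ f : H, ∫ ς, ‖ξ ς f‖ ^ 2 ∂μ ≤ B * ‖f‖ ^ 2)
    (hint : ∀ f : H, Integrable (fun ς => ContinuousLinearMap.adjoint (ξ ς) (χ ς f)) μ)
    (γ : ℝ) (hγ : 0 < γ)
    (hlow : ∀ f : H,
      γ * ‖ContinuousLinearMap.adjoint L f‖ ≤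
        ‖∫ ς, ContinuousLinearMap.adjoint (ξ ς) (χ ς f) ∂μ‖) :
    ∀ f : H,
      (γ ^ 2 / B) * ‖ContinuousLinearMap.adjoint L f‖ ^ 2 ≤ ∫ ς, ‖χ ς f‖ ^ 2 ∂μ := by
  intro f
  set v := ∫ ς, ContinuousLinearMap.adjoint (ξ ς) (χ ς f) ∂μ with hv
  have h1 : ∫ ς, RCLike.re (inner ℂ v (ContinuousLinearMap.adjoint (ξ ς) (χ ς f))) ∂μ
      = ‖v‖ ^ 2 := by
    have hi : Integrable
        (fun ς => inner ℂ v (ContinuousLinearMap.adjoint (ξ ς) (χ ς f))) μ :=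
      (hint f).const_inner v
    rw [integral_re hi, integral_inner (hint f) v, ← hv]
    exact inner_self_eq_norm_sq v
  have h2 : ∫ ς, RCLike.re (inner ℂ v (ContinuousLinearMap.adjoint (ξ ς) (χ ς f))) ∂μ
      ≤ ∫ ς, ((1 / (2 * B)) * ‖ξ ς v‖ ^ 2 + (B / 2) * ‖χ ς f‖ ^ 2) ∂μ := by
    apply integral_mono
    · exact ((hint f).const_inner v).re
    · exact ((hξint v).const_mul _).add ((hχint f).const_mul _)
    · intro ς
      show RCLike.re (inner ℂ v (ContinuousLinearMap.adjoint (ξ ς) (χ ς f))) ≤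
        (1 / (2 * B)) * ‖ξ ς v‖ ^ 2 + (B / 2) * ‖χ ς f‖ ^ 2
      rw [ContinuousLinearMap.adjoint_inner_right]
      refine (re_inner_le_norm _ _).trans ?_
      have h : (1 / (2 * B)) * ‖ξ ς v‖ ^ 2 + (B / 2) * ‖χ ς f‖ ^ 2 - ‖ξ ς v‖ * ‖χ ς f‖
          = (1 / (2 * B)) * (‖ξ ς v‖ - B * ‖χ ς f‖) ^ 2 := by
        field_simp
        ring
      have h' : 0 ≤ (1 / (2 * B)) * (‖ξ ς v‖ - B * ‖χ ς f‖) ^ 2 := by positivity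
      linarith
  rw [h1, integral_add ((hξint v).const_mul _) ((hχint f).const_mul _),
    integral_const_mul, integral_const_mul] at h2
  have h3 : (1 / (2 * B)) * ∫ ς, ‖ξ ς v‖ ^ 2 ∂μ ≤ ‖v‖ ^ 2 / 2 := by
    calc (1 / (2 * B)) * ∫ ς, ‖ξ ς v‖ ^ 2 ∂μ ≤ (1 / (2 * B)) * (B * ‖v‖ ^ 2) :=
          mul_le_mul_of_nonneg_left (hξ v) (by positivity)
      _ = ‖v‖ ^ 2 / 2 := by field_simp
  have h4 : (γ * ‖ContinuousLinearMap.adjoint L f‖) ^ 2 ≤ ‖v‖ ^ 2 :=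
    pow_le_pow_left₀ (by positivity) (hlow f) 2
  rw [div_mul_eq_mul_div, div_le_iff₀ hB, ← mul_pow]
  linarith
end

section
/- Let χ, ξ, χ', ξ' be continuous g-Bessel families, where χ has bound B₁ and ξ has bound B₂, and assume that for every f ∈ H the maps ς ↦ χ_ς*(χ'_ς f) and ς ↦ ξ_ς*(ξ'_ς f) are Bochner integrable. If there exists γ > 0 such that for every measurable set J ⊆ 𝔄 and every f ∈ H, ‖∫_J χ_ς*(χ'_ς f) dμ(ς) + ∫_{𝔄∖J} ξ_ς*(ξ'_ς f) dμ(ς)‖ ≥ γ‖L* f‖, then for every measurable J ⊆ 𝔄 and every f ∈ H, ∫_J ‖χ'_ς f‖² dμ(ς) + ∫_{𝔄∖J} ‖ξ'_ς f‖² dμ(ς) ≥ γ²‖L* f‖²/(√B₁ + √B₂)²; in particular χ' and ξ' are woven continuous L-g-frames. -/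
open MeasureTheory

/-- Synthesis bound for a g-Bessel family restricted to a measurable piece. -/
lemma bessel_synth_bound
    {𝔄 : Type*} [MeasurableSpace 𝔄] (μ : Measure 𝔄)
    {H K : Type*}
    [NormedAddCommGroup H] [InnerProductSpace ℂ H] [CompleteSpace H]
    [NormedAddCommGroup K] [InnerProductSpace ℂ K] [CompleteSpace K]
    (χ χ' : 𝔄 → (H →L[ℂ] K)) (B : ℝ) (hB : 0 < B)
    (hχint : ∀ f : H, Integrable (fun ς => ‖χ ς f‖ ^ 2) μ)
    (hχ : ∀ f : H, ∫ ς, ‖χ ς f‖ ^ 2 ∂μ ≤ B * ‖f‖ ^ 2)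
    (f : H) (hχ'int : Integrable (fun ς => ‖χ' ς f‖ ^ 2) μ)
    (hint : Integrable (fun ς => ContinuousLinearMap.adjoint (χ ς) (χ' ς f)) μ)
    (S : Set 𝔄) :
    ‖∫ ς in S, ContinuousLinearMap.adjoint (χ ς) (χ' ς f) ∂μ‖ ≤
      Real.sqrt B * Real.sqrt (∫ ς in S, ‖χ' ς f‖ ^ 2 ∂μ) := by
  set v := ∫ ς in S, ContinuousLinearMap.adjoint (χ ς) (χ' ς f) ∂μ with hv
  have hi := hint.restrict (s := S)
  have h1 : ‖v‖ ^ 2 =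
      ∫ ς in S, RCLike.re (inner ℂ v (ContinuousLinearMap.adjoint (χ ς) (χ' ς f))) ∂μ := by
    rw [integral_re (hi.const_inner v), integral_inner hi v, ← hv]
    exact (inner_self_eq_norm_sq (𝕜 := ℂ) v).symm
  have h2 : ‖v‖ ^ 2 ≤
      ∫ ς in S, ((1 / (2 * B)) * ‖χ ς v‖ ^ 2 + (B / 2) * ‖χ' ς f‖ ^ 2) ∂μ := by
    rw [h1]
    refine integral_mono (hi.const_inner v).re
      (((hχint v).restrict.const_mul _).add (hχ'int.restrict.const_mul _)) ?_
    intro ς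
    simp only [ContinuousLinearMap.adjoint_inner_right]
    refine (re_inner_le_norm (𝕜 := ℂ) (χ ς v) (χ' ς f)).trans ?_
    have h : (1 / (2 * B)) * ‖χ ς v‖ ^ 2 + (B / 2) * ‖χ' ς f‖ ^ 2 - ‖χ ς v‖ * ‖χ' ς f‖
        = (1 / (2 * B)) * (‖χ ς v‖ - B * ‖χ' ς f‖) ^ 2 := by
      field_simp
      ring
    have : 0 ≤ (1 / (2 * B)) * (‖χ ς v‖ - B * ‖χ' ς f‖) ^ 2 := by positivity
    linarith
  rw [integral_add ((hχint v).restrict.const_mul _) (hχ'int.restrict.const_mul _),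
    integral_const_mul, integral_const_mul] at h2
  have h3 : ∫ ς in S, ‖χ ς v‖ ^ 2 ∂μ ≤ B * ‖v‖ ^ 2 :=
    (setIntegral_le_integral (hχint v) (Filter.Eventually.of_forall fun _ => by positivity)).trans
      (hχ v)
  have h4 : (1 / (2 * B)) * ∫ ς in S, ‖χ ς v‖ ^ 2 ∂μ ≤ ‖v‖ ^ 2 / 2 := by
    calc _ ≤ (1 / (2 * B)) * (B * ‖v‖ ^ 2) := by gcongr
      _ = _ := by field_simp
  rw [← Real.sqrt_mul hB.le]
  apply Real.le_sqrt_of_sq_le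
  linarith

/-- If the woven mixed frame operators dominate γ‖L*f‖, then χ' and ξ' are woven
continuous L-g-frames with lower bound γ²/(√B₁+√B₂)². -/
theorem stmt_4
    {𝔄 : Type*} [MeasurableSpace 𝔄] (μ : Measure 𝔄)
    {H K : Type*}
    [NormedAddCommGroup H] [InnerProductSpace ℂ H] [CompleteSpace H]
    [NormedAddCommGroup K] [InnerProductSpace ℂ K] [CompleteSpace K]
    (L : H →L[ℂ] H) (χ ξ χ' ξ' : 𝔄 → (H →L[ℂ] K))
    (B₁ B₂ B₃ B₄ : ℝ) (hB₁ : 0 < B₁) (hB₂ : 0 < B₂) (hB₃ : 0 < B₃) (hB₄ : 0 < B₄)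
    (hχint : ∀ f : H, Integrable (fun ς => ‖χ ς f‖ ^ 2) μ)
    (hχ : ∀ f : H, ∫ ς, ‖χ ς f‖ ^ 2 ∂μ ≤ B₁ * ‖f‖ ^ 2)
    (hξint : ∀ f : H, Integrable (fun ς => ‖ξ ς f‖ ^ 2) μ)
    (hξ : ∀ f : H, ∫ ς, ‖ξ ς f‖ ^ 2 ∂μ ≤ B₂ * ‖f‖ ^ 2)
    (hχ'int : ∀ f : H, Integrable (fun ς => ‖χ' ς f‖ ^ 2) μ)
    (hχ' : ∀ f : H, ∫ ς, ‖χ' ς f‖ ^ 2 ∂μ ≤ B₃ * ‖f‖ ^ 2)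
    (hξ'int : ∀ f : H, Integrable (fun ς => ‖ξ' ς f‖ ^ 2) μ)
    (hξ' : ∀ f : H, ∫ ς, ‖ξ' ς f‖ ^ 2 ∂μ ≤ B₄ * ‖f‖ ^ 2)
    (hint₁ : ∀ f : H, Integrable (fun ς => ContinuousLinearMap.adjoint (χ ς) (χ' ς f)) μ)
    (hint₂ : ∀ f : H, Integrable (fun ς => ContinuousLinearMap.adjoint (ξ ς) (ξ' ς f)) μ)
    (γ : ℝ) (hγ : 0 < γ)
    (hlow : ∀ (J : Set 𝔄), MeasurableSet J → ∀ f : H,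
      γ * ‖ContinuousLinearMap.adjoint L f‖ ≤
        ‖(∫ ς in J, ContinuousLinearMap.adjoint (χ ς) (χ' ς f) ∂μ) +
          ∫ ς in Jᶜ, ContinuousLinearMap.adjoint (ξ ς) (ξ' ς f) ∂μ‖) :
    ∀ (J : Set 𝔄), MeasurableSet J → ∀ f : H,
      γ ^ 2 * ‖ContinuousLinearMap.adjoint L f‖ ^ 2 / (Real.sqrt B₁ + Real.sqrt B₂) ^ 2 ≤
        (∫ ς in J, ‖χ' ς f‖ ^ 2 ∂μ) + ∫ ς in Jᶜ, ‖ξ' ς f‖ ^ 2 ∂μ := by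
  intro J hJ f
  have h1 := bessel_synth_bound μ χ χ' B₁ hB₁ hχint hχ f (hχ'int f) (hint₁ f) J
  have h2 := bessel_synth_bound μ ξ ξ' B₂ hB₂ hξint hξ f (hξ'int f) (hint₂ f) Jᶜ
  have h3 := (hlow J hJ f).trans (norm_add_le _ _)
  have ha : 0 ≤ ∫ ς in J, ‖χ' ς f‖ ^ 2 ∂μ := integral_nonneg fun _ => by positivity
  have hb : 0 ≤ ∫ ς in Jᶜ, ‖ξ' ς f‖ ^ 2 ∂μ := integral_nonneg fun _ => by positivity
  generalize (∫ ς in J, ‖χ' ς f‖ ^ 2 ∂μ) = a at *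
  generalize (∫ ς in Jᶜ, ‖ξ' ς f‖ ^ 2 ∂μ) = b at *
  have s1 := Real.sqrt_pos.2 hB₁
  have s2 := Real.sqrt_pos.2 hB₂
  have h4 : γ * ‖ContinuousLinearMap.adjoint L f‖ ≤
      (Real.sqrt B₁ + Real.sqrt B₂) * Real.sqrt (a + b) := by
    have e1 : Real.sqrt a ≤ Real.sqrt (a + b) := Real.sqrt_le_sqrt (by linarith)
    have e2 : Real.sqrt b ≤ Real.sqrt (a + b) := Real.sqrt_le_sqrt (by linarith)
    have := mul_le_mul_of_nonneg_left e1 s1.le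
    have := mul_le_mul_of_nonneg_left e2 s2.le
    linarith
  rw [div_le_iff₀ (by positivity)]
  have h5 := pow_le_pow_left₀ (by positivity) h4 2
  rw [mul_pow, mul_pow, Real.sq_sqrt (by linarith)] at h5
  linarith
end

section
/- Let χ and ξ be continuous g-Bessel families such that for every f ∈ H the map ς ↦ ξ_ς*(χ_ς f) is Bochner integrable, and define S f = ∫_𝔄 ξ_ς*(χ_ς f) dμ(ς). Suppose L has closed range and ξ is an approximate L-dual of χ, i.e. there exists 0 < t < 1 with ‖L f − S f‖ ≤ t‖L f‖ for all f ∈ H. Then there exists a bounded linear operator U on H such that L f = U(S f) for every f ∈ H; in particular every element L f of the range of L can be reconstructed from {ξ_ς*(χ_ς f)}_{ς ∈ 𝔄}. -/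
open MeasureTheory

/-- If ξ is an approximate L-dual of χ and L has closed range, then there is a bounded
operator U with L f = U (S_{χ,ξ} f) for all f; in particular χ has an L-dual and each
L f can be reconstructed from {ξ_ς*(χ_ς f)}. -/
theorem stmt_8
    {𝔄 : Type*} [MeasurableSpace 𝔄] (μ : Measure 𝔄)
    {H K : Type*}
    [NormedAddCommGroup H] [InnerProductSpace ℂ H] [CompleteSpace H]
    [NormedAddCommGroup K] [InnerProductSpace ℂ K] [CompleteSpace K]
    (L : H →L[ℂ] H) (hL : IsClosed (Set.range L))
    (χ ξ : 𝔄 → (H →L[ℂ] K))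
    (B B' : ℝ) (hB : 0 < B) (hB' : 0 < B')
    (hχint : ∀ f : H, Integrable (fun ς => ‖χ ς f‖ ^ 2) μ)
    (hχ : ∀ f : H, ∫ ς, ‖χ ς f‖ ^ 2 ∂μ ≤ B * ‖f‖ ^ 2)
    (hξint : ∀ f : H, Integrable (fun ς => ‖ξ ς f‖ ^ 2) μ)
    (hξ : ∀ f : H, ∫ ς, ‖ξ ς f‖ ^ 2 ∂μ ≤ B' * ‖f‖ ^ 2)
    (hSint : ∀ f : H, Integrable (fun ς => ContinuousLinearMap.adjoint (ξ ς) (χ ς f)) μ)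
    (t : ℝ) (ht0 : 0 < t) (ht1 : t < 1)
    (happrox : ∀ f : H,
      ‖L f - ∫ ς, ContinuousLinearMap.adjoint (ξ ς) (χ ς f) ∂μ‖ ≤ t * ‖L f‖) :
    ∃ U : H →L[ℂ] H, ∀ f : H,
      L f = U (∫ ς, ContinuousLinearMap.adjoint (ξ ς) (χ ς f) ∂μ) := by
  let S : H →ₗ[ℂ] H :=
    { toFun := fun f => ∫ ς, ContinuousLinearMap.adjoint (ξ ς) (χ ς f) ∂μ
      map_add' := by
        intro f g
        rw [← integral_add (hSint f) (hSint g)]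
        simp only [map_add]
      map_smul' := by
        intro c f
        simp only [RingHom.id_apply]
        rw [← integral_smul]
        simp only [map_smul] }
  let D : H →ₗ[ℂ] H := L.toLinearMap - S
  have hD : ∀ f, ‖D f‖ ≤ t * ‖L f‖ := happrox
  obtain ⟨g, hg⟩ := LinearMap.exists_rightInverse_of_surjective L.toLinearMap.rangeRestrict
    (LinearMap.range_rangeRestrict _)
  have hLg : ∀ y : L.toLinearMap.range, L (g y) = y := by
    intro y
    have := congrArg Subtype.val (LinearMap.congr_fun hg y)
    simpa using this
  let V : L.toLinearMap.range →L[ℂ] H := (D ∘ₗ g).mkContinuous t (by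
    intro y
    have := hD (g y)
    rw [hLg] at this
    exact this)
  have hVn : ‖V‖ ≤ t := LinearMap.mkContinuous_norm_le _ ht0.le _
  have hVL : ∀ f, V (L.toLinearMap.rangeRestrict f) = D f := by
    intro f
    have h1 := hD (g (L.toLinearMap.rangeRestrict f) - f)
    have h2 : L (g (L.toLinearMap.rangeRestrict f) - f) = 0 := by
      rw [map_sub, hLg]
      simp
    rw [h2, norm_zero, mul_zero, map_sub] at h1
    exact sub_eq_zero.mp (norm_le_zero_iff.mp h1)
  have hcl : IsClosed (L.toLinearMap.range : Set H) := by
    rw [LinearMap.coe_range]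
    exact hL
  have : CompleteSpace L.toLinearMap.range := hcl.completeSpace_coe
  let W : H →L[ℂ] H := V ∘L L.toLinearMap.range.orthogonalProjectionOnto
  have hW : ‖W‖ < 1 := by
    calc ‖W‖ ≤ ‖V‖ * ‖L.toLinearMap.range.orthogonalProjectionOnto‖ :=
          ContinuousLinearMap.opNorm_comp_le _ _
      _ ≤ t * 1 := mul_le_mul hVn (Submodule.orthogonalProjectionOnto_norm_le _)
          (ContinuousLinearMap.opNorm_nonneg _) ht0.le
      _ < 1 := by linarith
  have hWL : ∀ f, W (L f) = D f := by
    intro f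
    rw [← hVL f]
    change V _ = V _
    congr 1
    exact Submodule.orthogonalProjectionOnto_mem_subspace_eq_self (L.toLinearMap.rangeRestrict f)
  let u := Units.oneSub W hW
  refine ⟨(↑u⁻¹ : H →L[ℂ] H), fun f => ?_⟩
  have h1 : (u : H →L[ℂ] H) (L f) = S f := by
    change L f - W (L f) = S f
    rw [hWL]
    change L f - (L f - S f) = S f
    abel
  change L f = (↑u⁻¹ : H →L[ℂ] H) (S f)
  rw [← h1, ← ContinuousLinearMap.mul_apply, Units.inv_mul]
  rfl
end

section
/- Let χ = {χ_ς ∈ B(H, K)} be a continuous g-Bessel family and let Φ = {φ_ς ∈ B(H, K)} be a continuous g-Bessel family with bound D that is an approximate L-dual of χ with constant 0 < t < 1, i.e. ‖L f − ∫_𝔄 φ_ς*(χ_ς f) dμ(ς)‖ ≤ t‖L f‖ for all f ∈ H. Suppose ξ = {ξ_ς ∈ B(H, K)} is a family such that for every f ∈ H: the functions ς ↦ ‖(χ_ς − ξ_ς) f‖² and ς ↦ ‖ξ_ς f‖² are integrable, the maps ς ↦ φ_ς*(χ_ς f) and ς ↦ φ_ς*(ξ_ς f) are Bochner integrable, and (∫_𝔄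 ‖(χ_ς − ξ_ς) f‖² dμ(ς))^{1/2} ≤ G‖L f‖ for a constant G ≥ 0 with t + √D·G < 1. Then Φ is an approximate L-dual of ξ: for all f ∈ H, ‖L f − ∫_𝔄 φ_ς*(ξ_ς f) dμ(ς)‖ ≤ (t + √D·G)‖L f‖. -/
open MeasureTheory

/-- Approximate L-duals are stable under small perturbations: if Φ is an approximate
L-dual of χ with constant t and ξ is G-close to χ with t + √D·G < 1, then Φ is an
approximate L-dual of ξ with constant t + √D·G. -/
theorem stmt_10
    {𝔄 : Type*} [MeasurableSpace 𝔄] (μ : Measure 𝔄)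
    {H K : Type*}
    [NormedAddCommGroup H] [InnerProductSpace ℂ H] [CompleteSpace H]
    [NormedAddCommGroup K] [InnerProductSpace ℂ K] [CompleteSpace K]
    (L : H →L[ℂ] H) (χ φ ξ : 𝔄 → (H →L[ℂ] K))
    (B D : ℝ) (hB : 0 < B) (hD : 0 < D)
    (hχint : ∀ f : H, Integrable (fun ς => ‖χ ς f‖ ^ 2) μ)
    (hχ : ∀ f : H, ∫ ς, ‖χ ς f‖ ^ 2 ∂μ ≤ B * ‖f‖ ^ 2)
    (hφint : ∀ f : H, Integrable (fun ς => ‖φ ς f‖ ^ 2) μ)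
    (hφ : ∀ f : H, ∫ ς, ‖φ ς f‖ ^ 2 ∂μ ≤ D * ‖f‖ ^ 2)
    (t : ℝ) (ht0 : 0 < t) (ht1 : t < 1)
    (hSχint : ∀ f : H, Integrable (fun ς => ContinuousLinearMap.adjoint (φ ς) (χ ς f)) μ)
    (happrox : ∀ f : H,
      ‖L f - ∫ ς, ContinuousLinearMap.adjoint (φ ς) (χ ς f) ∂μ‖ ≤ t * ‖L f‖)
    (hξint : ∀ f : H, Integrable (fun ς => ‖ξ ς f‖ ^ 2) μ)
    (hdiffint : ∀ f : H, Integrable (fun ς => ‖χ ς f - ξ ς f‖ ^ 2) μ)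
    (hSξint : ∀ f : H, Integrable (fun ς => ContinuousLinearMap.adjoint (φ ς) (ξ ς f)) μ)
    (G : ℝ) (hG : 0 ≤ G)
    (hdiff : ∀ f : H, Real.sqrt (∫ ς, ‖χ ς f - ξ ς f‖ ^ 2 ∂μ) ≤ G * ‖L f‖)
    (hsmall : t + Real.sqrt D * G < 1) :
    ∀ f : H,
      ‖L f - ∫ ς, ContinuousLinearMap.adjoint (φ ς) (ξ ς f) ∂μ‖ ≤
        (t + Real.sqrt D * G) * ‖L f‖ := by
  intro f
  set d : 𝔄 → K := fun ς => χ ς f - ξ ς f with hd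
  have hint : Integrable (fun ς => ContinuousLinearMap.adjoint (φ ς) (d ς)) μ := by
    have := (hSχint f).sub (hSξint f)
    refine this.congr (Filter.Eventually.of_forall fun ς => ?_)
    simp [hd, map_sub]
  set v : H := ∫ ς, ContinuousLinearMap.adjoint (φ ς) (d ς) ∂μ with hv
  have hveq : v = (∫ ς, ContinuousLinearMap.adjoint (φ ς) (χ ς f) ∂μ)
      - ∫ ς, ContinuousLinearMap.adjoint (φ ς) (ξ ς f) ∂μ := by
    rw [← integral_sub (hSχint f) (hSξint f), hv]
    simp [hd, map_sub]
  have memL : ∀ g : 𝔄 → K, Integrable (fun ς => ‖g ς‖ ^ 2) μ →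
      MemLp (fun ς => ‖g ς‖) 2 μ := by
    intro g hg
    have hm : AEStronglyMeasurable (fun ς => ‖g ς‖) μ := by
      have h := hg.aestronglyMeasurable.aemeasurable.sqrt.aestronglyMeasurable
      simpa [Real.sqrt_sq] using h
    exact (memLp_two_iff_integrable_sq hm).2 hg
  have h1 := memL (fun ς => φ ς v) (hφint v)
  have h2 := memL d (hdiffint f)
  have hcs : ∫ ς, ‖φ ς v‖ * ‖d ς‖ ∂μ ≤
      Real.sqrt (∫ ς, ‖φ ς v‖ ^ 2 ∂μ) * Real.sqrt (∫ ς, ‖d ς‖ ^ 2 ∂μ) := by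
    have := integral_mul_le_Lp_mul_Lq_of_nonneg (μ := μ) Real.HolderConjugate.two_two
      (f := fun ς => ‖φ ς v‖) (g := fun ς => ‖d ς‖)
      (Filter.Eventually.of_forall fun _ => norm_nonneg _)
      (Filter.Eventually.of_forall fun _ => norm_nonneg _)
      (by simpa using h1) (by simpa using h2)
    simpa [Real.sqrt_eq_rpow] using this
  have hsq : ‖v‖ ^ 2 ≤ ∫ ς, ‖φ ς v‖ * ‖d ς‖ ∂μ := by
    have e : inner ℂ v v = ∫ ς, inner ℂ v (ContinuousLinearMap.adjoint (φ ς) (d ς)) ∂μ :=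
      (integral_inner hint v).symm
    have e2 : ‖v‖ ^ 2 = ‖inner ℂ v v‖ := by
      rw [inner_self_eq_norm_sq_to_K]; simp
    rw [e2, e]
    refine norm_integral_le_of_norm_le (h1.integrable_mul h2) ?_
    refine Filter.Eventually.of_forall fun ς => ?_
    rw [ContinuousLinearMap.adjoint_inner_right]
    exact norm_inner_le_norm _ _
  have hφv : Real.sqrt (∫ ς, ‖φ ς v‖ ^ 2 ∂μ) ≤ Real.sqrt D * ‖v‖ := by
    refine (Real.sqrt_le_sqrt (hφ v)).trans (le_of_eq ?_)
    rw [Real.sqrt_mul hD.le, Real.sqrt_sq (norm_nonneg v)]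
  have hmain : ‖v‖ ^ 2 ≤ (Real.sqrt D * ‖v‖) * (G * ‖L f‖) :=
    hsq.trans (hcs.trans (mul_le_mul hφv (hdiff f) (Real.sqrt_nonneg _) (by positivity)))
  have hvle : ‖v‖ ≤ Real.sqrt D * G * ‖L f‖ := by
    rcases (norm_nonneg v).eq_or_lt with h0 | h0
    · rw [← h0]; positivity
    · refine le_of_mul_le_mul_left ?_ h0
      nlinarith [hmain]
  have hfin : L f - ∫ ς, ContinuousLinearMap.adjoint (φ ς) (ξ ς f) ∂μ
      = (L f - ∫ ς, ContinuousLinearMap.adjoint (φ ς) (χ ς f) ∂μ) + v := by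
    rw [hveq]; abel
  rw [hfin, add_mul]
  exact (norm_add_le _ _).trans (add_le_add (happrox f) hvle)
end

section
/- Let χ = {χ_ς ∈ B(H, K)} and ξ = {ξ_ς ∈ B(H, K)} be (A, B)-woven continuous L-g-frames, let K₀ ∈ B(H), and for each ς ∈ 𝔄 let K_ς, K'_ς ∈ B(K). Suppose there exist 0 < α < β < ∞ such that for every ς ∈ 𝔄 and every v ∈ K: α‖v‖ ≤ ‖K_ς v‖, α‖v‖ ≤ ‖K'_ς v‖, ‖K_ς v‖ ≤ β‖v‖, and ‖K'_ς v‖ ≤ β‖v‖. Then {K_ς ∘ χ_ς ∘ K₀} and {K'_ς ∘ ξ_ς ∘ K₀} are (α²A, β²B‖K₀‖²)-woven continuous (K₀* L)-g-frames: for every measurable set J ⊆ 𝔄 and every f ∈ H, α²A‖L*(K₀ f)‖² ≤ ∫_J ‖K_ς(χ_ς(K₀ f))‖² dμ(ς) + ∫_{𝔄∖J} ‖K'_ς(ξ_ς(K₀ f))‖² dμ(ς) ≤ β²B‖K₀‖²‖f‖² (note (K₀* L)* f = L*(K₀ f)). -/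
open MeasureTheory

/-- Bounded-below, bounded-above multiplications of woven continuous L-g-frames are
woven continuous (K₀*L)-g-frames with bounds α²A and β²B‖K₀‖². -/
theorem stmt_11
    {𝔄 : Type*} [MeasurableSpace 𝔄] (μ : Measure 𝔄)
    {H K : Type*}
    [NormedAddCommGroup H] [InnerProductSpace ℂ H] [CompleteSpace H]
    [NormedAddCommGroup K] [InnerProductSpace ℂ K] [CompleteSpace K]
    (L : H →L[ℂ] H)
    (χ ξ : 𝔄 → (H →L[ℂ] K))
    (A B : ℝ) (hA : 0 < A) (hAB : A ≤ B)
    (hχint : ∀ f : H, Integrable (fun ς => ‖χ ς f‖ ^ 2) μ)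
    (hξint : ∀ f : H, Integrable (fun ς => ‖ξ ς f‖ ^ 2) μ)
    (hwoven : ∀ (J : Set 𝔄), MeasurableSet J → ∀ f : H,
      A * ‖ContinuousLinearMap.adjoint L f‖ ^ 2 ≤
          (∫ ς in J, ‖χ ς f‖ ^ 2 ∂μ) + ∫ ς in Jᶜ, ‖ξ ς f‖ ^ 2 ∂μ ∧
        (∫ ς in J, ‖χ ς f‖ ^ 2 ∂μ) + ∫ ς in Jᶜ, ‖ξ ς f‖ ^ 2 ∂μ ≤ B * ‖f‖ ^ 2)
    (K₀ : H →L[ℂ] H) (Kf Kf' : 𝔄 → (K →L[ℂ] K))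
    (α β : ℝ) (hα : 0 < α) (hαβ : α < β)
    (hKlow : ∀ (ς : 𝔄) (v : K), α * ‖v‖ ≤ ‖Kf ς v‖)
    (hK'low : ∀ (ς : 𝔄) (v : K), α * ‖v‖ ≤ ‖Kf' ς v‖)
    (hKup : ∀ (ς : 𝔄) (v : K), ‖Kf ς v‖ ≤ β * ‖v‖)
    (hK'up : ∀ (ς : 𝔄) (v : K), ‖Kf' ς v‖ ≤ β * ‖v‖)
    (hKχint : ∀ f : H, Integrable (fun ς => ‖Kf ς (χ ς f)‖ ^ 2) μ)
    (hKξint : ∀ f : H, Integrable (fun ς => ‖Kf' ς (ξ ς f)‖ ^ 2) μ) :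
    ∀ (J : Set 𝔄), MeasurableSet J → ∀ f : H,
      α ^ 2 * A * ‖ContinuousLinearMap.adjoint L (K₀ f)‖ ^ 2 ≤
          (∫ ς in J, ‖Kf ς (χ ς (K₀ f))‖ ^ 2 ∂μ) +
            ∫ ς in Jᶜ, ‖Kf' ς (ξ ς (K₀ f))‖ ^ 2 ∂μ ∧
        (∫ ς in J, ‖Kf ς (χ ς (K₀ f))‖ ^ 2 ∂μ) +
            ∫ ς in Jᶜ, ‖Kf' ς (ξ ς (K₀ f))‖ ^ 2 ∂μ ≤
          β ^ 2 * B * ‖K₀‖ ^ 2 * ‖f‖ ^ 2 := by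
  intro J hJ f
  obtain ⟨h1, h2⟩ := hwoven J hJ (K₀ f)
  have hβ : 0 < β := hα.trans hαβ
  have low : ∀ (S : Set 𝔄) (g k : 𝔄 → K), Integrable (fun ς => ‖g ς‖ ^ 2) μ →
      Integrable (fun ς => ‖k ς‖ ^ 2) μ → ∀ c : ℝ, 0 < c → (∀ ς, c * ‖g ς‖ ≤ ‖k ς‖) →
      c ^ 2 * ∫ ς in S, ‖g ς‖ ^ 2 ∂μ ≤ ∫ ς in S, ‖k ς‖ ^ 2 ∂μ := by
    intro S g k hg hk c hc h
    rw [← integral_const_mul]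
    refine integral_mono (hg.integrableOn.const_mul _) hk.integrableOn fun ς => ?_
    have := pow_le_pow_left₀ (by positivity) (h ς) 2
    simpa [mul_pow] using this
  have up : ∀ (S : Set 𝔄) (g k : 𝔄 → K), Integrable (fun ς => ‖g ς‖ ^ 2) μ →
      Integrable (fun ς => ‖k ς‖ ^ 2) μ → (∀ ς, ‖k ς‖ ≤ β * ‖g ς‖) →
      ∫ ς in S, ‖k ς‖ ^ 2 ∂μ ≤ β ^ 2 * ∫ ς in S, ‖g ς‖ ^ 2 ∂μ := by
    intro S g k hg hk h
    rw [← integral_const_mul]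
    refine integral_mono hk.integrableOn (hg.integrableOn.const_mul _) fun ς => ?_
    have := pow_le_pow_left₀ (by positivity) (h ς) 2
    simpa [mul_pow] using this
  have l1 := low J _ _ (hχint (K₀ f)) (hKχint (K₀ f)) α hα fun ς => hKlow ς _
  have l2 := low Jᶜ _ _ (hξint (K₀ f)) (hKξint (K₀ f)) α hα fun ς => hK'low ς _
  have u1 := up J _ _ (hχint (K₀ f)) (hKχint (K₀ f)) fun ς => hKup ς _
  have u2 := up Jᶜ _ _ (hξint (K₀ f)) (hKξint (K₀ f)) fun ς => hK'up ς _
  have hn : ‖K₀ f‖ ^ 2 ≤ ‖K₀‖ ^ 2 * ‖f‖ ^ 2 := by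
    rw [← mul_pow]
    exact pow_le_pow_left₀ (norm_nonneg _) (K₀.le_opNorm f) 2
  have hB : 0 ≤ B := hA.le.trans hAB
  have m1 := mul_le_mul_of_nonneg_left h1 (sq_nonneg α)
  have m2 := mul_le_mul_of_nonneg_left (h2.trans (mul_le_mul_of_nonneg_left hn hB)) (sq_nonneg β)
  rw [mul_add] at m1 m2
  constructor
  · rw [mul_assoc]
    linarith
  · have e : β ^ 2 * B * ‖K₀‖ ^ 2 * ‖f‖ ^ 2 = β ^ 2 * (B * (‖K₀‖ ^ 2 * ‖f‖ ^ 2)) := by ring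
    rw [e]
    linarith
end

section
/- Let χ = {χ_ς ∈ B(H, K)} be a continuous L-g-frame with bounds A, B, and let T ∈ B(H) be invertible with T L* = L* T. Then {χ_ς ∘ T}_{ς ∈ 𝔄} is a continuous L-g-frame with bounds A/‖T⁻¹‖² and B‖T‖²: for every f ∈ H, (A/‖T⁻¹‖²)‖L* f‖² ≤ ∫_𝔄 ‖χ_ς(T f)‖² dμ(ς) ≤ B‖T‖²‖f‖². -/
open MeasureTheory

/-- Right composition of a continuous L-g-frame with an invertible operator commuting
with L* yields a continuous L-g-frame with bounds A/‖T⁻¹‖² and B‖T‖². -/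
theorem stmt_12
    {𝔄 : Type*} [MeasurableSpace 𝔄] (μ : Measure 𝔄)
    {H K : Type*}
    [NormedAddCommGroup H] [InnerProductSpace ℂ H] [CompleteSpace H]
    [NormedAddCommGroup K] [InnerProductSpace ℂ K] [CompleteSpace K]
    (L : H →L[ℂ] H) (χ : 𝔄 → (H →L[ℂ] K))
    (A B : ℝ) (hA : 0 < A) (hAB : A ≤ B)
    (hχint : ∀ f : H, Integrable (fun ς => ‖χ ς f‖ ^ 2) μ)
    (hframe : ∀ f : H,
      A * ‖ContinuousLinearMap.adjoint L f‖ ^ 2 ≤ ∫ ς, ‖χ ς f‖ ^ 2 ∂μ ∧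
        ∫ ς, ‖χ ς f‖ ^ 2 ∂μ ≤ B * ‖f‖ ^ 2)
    (T : H ≃L[ℂ] H)
    (hcomm : ∀ f : H,
      T (ContinuousLinearMap.adjoint L f) = ContinuousLinearMap.adjoint L (T f)) :
    ∀ f : H,
      (A / ‖(T.symm : H →L[ℂ] H)‖ ^ 2) * ‖ContinuousLinearMap.adjoint L f‖ ^ 2 ≤
          ∫ ς, ‖χ ς (T f)‖ ^ 2 ∂μ ∧
        ∫ ς, ‖χ ς (T f)‖ ^ 2 ∂μ ≤ B * ‖(T : H →L[ℂ] H)‖ ^ 2 * ‖f‖ ^ 2 := by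
  intro f
  have hB : 0 ≤ B := hA.le.trans hAB
  obtain ⟨h1, h2⟩ := hframe (T f)
  constructor
  · refine le_trans ?_ h1
    rw [← hcomm f]
    set g := ContinuousLinearMap.adjoint L f
    have hg : ‖g‖ ≤ ‖(T.symm : H →L[ℂ] H)‖ * ‖T g‖ := by
      have := (T.symm : H →L[ℂ] H).le_opNorm (T g)
      simpa using this
    set c := ‖(T.symm : H →L[ℂ] H)‖ with hc
    have hc0 : 0 ≤ c := norm_nonneg _
    rcases hc0.eq_or_lt with h0 | hpos
    · rw [← h0]
      simp only [ne_eq, OfNat.ofNat_ne_zero, not_false_eq_true, zero_pow, div_zero, zero_mul]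
      positivity
    · rw [div_mul_eq_mul_div, div_le_iff₀ (by positivity), mul_assoc]
      refine mul_le_mul_of_nonneg_left ?_ hA.le
      calc ‖g‖ ^ 2 ≤ (c * ‖T g‖) ^ 2 := pow_le_pow_left₀ (norm_nonneg _) hg 2
        _ = ‖T g‖ ^ 2 * c ^ 2 := by ring
  · refine h2.trans ?_
    rw [mul_assoc, ← mul_pow]
    exact mul_le_mul_of_nonneg_left
      (pow_le_pow_left₀ (norm_nonneg _) ((T : H →L[ℂ] H).le_opNorm f) 2) hB
end

section
/- Let χ = {χ_ς ∈ B(H, K)} be a continuous L-g-frame with bounds A, B, and let M ∈ B(K) be invertible. Then {M ∘ χ_ς}_{ς ∈ 𝔄} is a continuous L-g-frame with bounds A/‖M⁻¹‖² and B‖M‖²: for every f ∈ H, (A/‖M⁻¹‖²)‖L* f‖² ≤ ∫_𝔄 ‖M(χ_ς f)‖² dμ(ς) ≤ B‖M‖²‖f‖². -/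
open MeasureTheory

/-- Left composition of a continuous L-g-frame with an invertible operator yields a
continuous L-g-frame with bounds A/‖M⁻¹‖² and B‖M‖². -/
theorem stmt_13
    {𝔄 : Type*} [MeasurableSpace 𝔄] (μ : Measure 𝔄)
    {H K : Type*}
    [NormedAddCommGroup H] [InnerProductSpace ℂ H] [CompleteSpace H]
    [NormedAddCommGroup K] [InnerProductSpace ℂ K] [CompleteSpace K]
    (L : H →L[ℂ] H) (χ : 𝔄 → (H →L[ℂ] K))
    (A B : ℝ) (hA : 0 < A) (hAB : A ≤ B)
    (hχmes : ∀ f : H, AEStronglyMeasurable (fun ς => χ ς f) μ)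
    (hχint : ∀ f : H, Integrable (fun ς => ‖χ ς f‖ ^ 2) μ)
    (hframe : ∀ f : H,
      A * ‖ContinuousLinearMap.adjoint L f‖ ^ 2 ≤ ∫ ς, ‖χ ς f‖ ^ 2 ∂μ ∧
        ∫ ς, ‖χ ς f‖ ^ 2 ∂μ ≤ B * ‖f‖ ^ 2)
    (M : K ≃L[ℂ] K) :
    ∀ f : H,
      (A / ‖(M.symm : K →L[ℂ] K)‖ ^ 2) * ‖ContinuousLinearMap.adjoint L f‖ ^ 2 ≤
          ∫ ς, ‖M (χ ς f)‖ ^ 2 ∂μ ∧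
        ∫ ς, ‖M (χ ς f)‖ ^ 2 ∂μ ≤ B * ‖(M : K →L[ℂ] K)‖ ^ 2 * ‖f‖ ^ 2 := by
  intro f
  have hub : ∀ ς, ‖M (χ ς f)‖ ^ 2 ≤ ‖(M : K →L[ℂ] K)‖ ^ 2 * ‖χ ς f‖ ^ 2 := by
    intro ς
    rw [← mul_pow]
    exact pow_le_pow_left₀ (norm_nonneg _) ((M : K →L[ℂ] K).le_opNorm (χ ς f)) 2
  have hlb : ∀ ς, ‖χ ς f‖ ^ 2 ≤ ‖(M.symm : K →L[ℂ] K)‖ ^ 2 * ‖M (χ ς f)‖ ^ 2 := by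
    intro ς
    rw [← mul_pow]
    refine pow_le_pow_left₀ (norm_nonneg _) ?_ 2
    have h := (M.symm : K →L[ℂ] K).le_opNorm (M (χ ς f))
    simpa using h
  have hdom : Integrable (fun ς => ‖(M : K →L[ℂ] K)‖ ^ 2 * ‖χ ς f‖ ^ 2) μ :=
    (hχint f).const_mul _
  have hint : Integrable (fun ς => ‖M (χ ς f)‖ ^ 2) μ := by
    refine hdom.mono' ((M.continuous.comp_aestronglyMeasurable (hχmes f)).norm.pow 2) ?_
    refine Filter.Eventually.of_forall fun ς => ?_
    rw [Real.norm_of_nonneg (by positivity)]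
    exact hub ς
  have hnn : 0 ≤ ∫ ς, ‖M (χ ς f)‖ ^ 2 ∂μ := integral_nonneg fun ς => by positivity
  obtain ⟨h1, h2⟩ := hframe f
  constructor
  · have h3 := integral_mono (hχint f)
      (hint.const_mul (‖(M.symm : K →L[ℂ] K)‖ ^ 2)) hlb
    rw [integral_const_mul] at h3
    rw [div_mul_eq_mul_div]
    exact div_le_of_le_mul₀ (by positivity) hnn (by linarith)
  · have h3 := integral_mono hint hdom hub
    rw [integral_const_mul] at h3
    have h4 := mul_le_mul_of_nonneg_left h2 (sq_nonneg ‖(M : K →L[ℂ] K)‖)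
    linarith
end

section
/- Let χ = {χ_ς} and ξ = {ξ_ς} be (A, B)-woven continuous L-g-frames, let J ⊆ 𝔄 be measurable, and suppose there exists 0 < C < A such that ∫_J ‖χ_ς f‖² dμ(ς) ≤ C‖L* f‖² for all f ∈ H. Then the restricted families {χ_ς}_{ς ∈ 𝔄∖J} and {ξ_ς}_{ς ∈ 𝔄∖J} are (A − C, B)-woven continuous L-g-frames: for every measurable set E ⊆ 𝔄∖J and every f ∈ H, (A − C)‖L* f‖² ≤ ∫_E ‖χ_ς f‖² dμ(ς) + ∫_{(𝔄∖J)∖E} ‖ξ_ς f‖² dμ(ς) ≤ B‖f‖². -/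
open MeasureTheory

/-- Removing a set J on which χ has an upper L-g-frame bound C < A from (A,B)-woven
continuous L-g-frames leaves (A−C,B)-woven continuous L-g-frames. -/
theorem stmt_14
    {𝔄 : Type*} [MeasurableSpace 𝔄] (μ : Measure 𝔄)
    {H K : Type*}
    [NormedAddCommGroup H] [InnerProductSpace ℂ H] [CompleteSpace H]
    [NormedAddCommGroup K] [InnerProductSpace ℂ K] [CompleteSpace K]
    (L : H →L[ℂ] H)
    (χ ξ : 𝔄 → (H →L[ℂ] K))
    (A B : ℝ) (hA : 0 < A) (hAB : A ≤ B)
    (hχint : ∀ f : H, Integrable (fun ς => ‖χ ς f‖ ^ 2) μ)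
    (hξint : ∀ f : H, Integrable (fun ς => ‖ξ ς f‖ ^ 2) μ)
    (hwoven : ∀ (J : Set 𝔄), MeasurableSet J → ∀ f : H,
      A * ‖ContinuousLinearMap.adjoint L f‖ ^ 2 ≤
          (∫ ς in J, ‖χ ς f‖ ^ 2 ∂μ) + ∫ ς in Jᶜ, ‖ξ ς f‖ ^ 2 ∂μ ∧
        (∫ ς in J, ‖χ ς f‖ ^ 2 ∂μ) + ∫ ς in Jᶜ, ‖ξ ς f‖ ^ 2 ∂μ ≤ B * ‖f‖ ^ 2)
    (J : Set 𝔄) (hJ : MeasurableSet J)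
    (C : ℝ) (hC0 : 0 < C) (hCA : C < A)
    (hsmall : ∀ f : H,
      ∫ ς in J, ‖χ ς f‖ ^ 2 ∂μ ≤ C * ‖ContinuousLinearMap.adjoint L f‖ ^ 2) :
    ∀ (E : Set 𝔄), MeasurableSet E → E ⊆ Jᶜ → ∀ f : H,
      (A - C) * ‖ContinuousLinearMap.adjoint L f‖ ^ 2 ≤
          (∫ ς in E, ‖χ ς f‖ ^ 2 ∂μ) + ∫ ς in Jᶜ \ E, ‖ξ ς f‖ ^ 2 ∂μ ∧
        (∫ ς in E, ‖χ ς f‖ ^ 2 ∂μ) + ∫ ς in Jᶜ \ E, ‖ξ ς f‖ ^ 2 ∂μ ≤ B * ‖f‖ ^ 2 := by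
  intro E hE hEJ f
  have hdisj : Disjoint J E := Set.disjoint_left.mpr fun x hx hxE => hEJ hxE hx
  have hset : (J ∪ E)ᶜ = Jᶜ \ E := by
    rw [Set.compl_union, Set.diff_eq]
  have hsplit : ∫ ς in J ∪ E, ‖χ ς f‖ ^ 2 ∂μ
      = (∫ ς in J, ‖χ ς f‖ ^ 2 ∂μ) + ∫ ς in E, ‖χ ς f‖ ^ 2 ∂μ :=
    setIntegral_union hdisj hE (hχint f).integrableOn (hχint f).integrableOn
  have hnn : 0 ≤ ∫ ς in J, ‖χ ς f‖ ^ 2 ∂μ := integral_nonneg fun ς => sq_nonneg _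
  obtain ⟨h1, h2⟩ := hwoven (J ∪ E) (hJ.union hE) f
  rw [hset, hsplit] at h1 h2
  have h3 := hsmall f
  constructor
  · rw [sub_mul]
    linarith
  · linarith
end

section
/- Let χ = {χ_ς ∈ B(H, K)} be a continuous L-g-frame with bounds A, B. If for some measurable set J ⊆ 𝔄 and some 0 < C < A one has ∫_J ‖χ_ς f‖² dμ(ς) ≤ C‖L* f‖² for all f ∈ H, then the restricted family {χ_ς}_{ς ∈ 𝔄∖J} is a continuous L-g-frame with lower bound A − C: for every f ∈ H, (A − C)‖L* f‖² ≤ ∫_{𝔄∖J} ‖χ_ς f‖² dμ(ς) ≤ B‖f‖². -/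
open MeasureTheory

/-- Removing a set J on which a continuous L-g-frame has an upper bound C < A leaves a
continuous L-g-frame with lower bound A − C. -/
theorem stmt_15
    {𝔄 : Type*} [MeasurableSpace 𝔄] (μ : Measure 𝔄)
    {H K : Type*}
    [NormedAddCommGroup H] [InnerProductSpace ℂ H] [CompleteSpace H]
    [NormedAddCommGroup K] [InnerProductSpace ℂ K] [CompleteSpace K]
    (L : H →L[ℂ] H) (χ : 𝔄 → (H →L[ℂ] K))
    (A B : ℝ) (hA : 0 < A) (hAB : A ≤ B)
    (hχint : ∀ f : H, Integrable (fun ς => ‖χ ς f‖ ^ 2) μ)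
    (hframe : ∀ f : H,
      A * ‖ContinuousLinearMap.adjoint L f‖ ^ 2 ≤ ∫ ς, ‖χ ς f‖ ^ 2 ∂μ ∧
        ∫ ς, ‖χ ς f‖ ^ 2 ∂μ ≤ B * ‖f‖ ^ 2)
    (J : Set 𝔄) (hJ : MeasurableSet J)
    (C : ℝ) (hC0 : 0 < C) (hCA : C < A)
    (hsmall : ∀ f : H,
      ∫ ς in J, ‖χ ς f‖ ^ 2 ∂μ ≤ C * ‖ContinuousLinearMap.adjoint L f‖ ^ 2) :
    ∀ f : H,
      (A - C) * ‖ContinuousLinearMap.adjoint L f‖ ^ 2 ≤ ∫ ς in Jᶜ, ‖χ ς f‖ ^ 2 ∂μ ∧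
        ∫ ς in Jᶜ, ‖χ ς f‖ ^ 2 ∂μ ≤ B * ‖f‖ ^ 2 := by
  intro f
  have h := integral_add_compl hJ (hχint f)
  have h0 : 0 ≤ ∫ ς in J, ‖χ ς f‖ ^ 2 ∂μ := integral_nonneg fun ς => by positivity
  have h1 := hframe f
  have h2 := hsmall f
  constructor
  · rw [sub_mul]
    linarith [h1.1]
  · linarith [h1.2]
end

section
/- Let χ = {χ_ς} and ξ = {ξ_ς} be (A, B)-woven continuous L-g-frames, let 0 ≤ α₁, α₂, β₁, β₂ < 1, and let χ' = {χ'_ς} be an (α₁, α₂)-perturbation of χ and ξ' = {ξ'_ς} a (β₁, β₂)-perturbation of ξ, i.e. ‖χ_ς f − χ'_ς f‖ ≤ α₁‖χ_ς f‖ + α₂‖χ'_ς f‖ and ‖ξ_ς f − ξ'_ς f‖ ≤ β₁‖ξ_ς f‖ + β₂‖ξ'_ς f‖ for all ς ∈ 𝔄 and f ∈ H (with ς ↦ ‖χ'_ς f‖² and ς ↦ ‖ξ'_ς f‖² integrable). Then χ' and ξ' are woven continuous L-g-frames: for every measurable set J ⊆ 𝔄 and every f ∈ H, min{((1−α₁)/(1+α₂))²,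 ((1−β₁)/(1+β₂))²}·A·‖L* f‖² ≤ ∫_J ‖χ'_ς f‖² dμ(ς) + ∫_{𝔄∖J} ‖ξ'_ς f‖² dμ(ς) ≤ max{((1+α₁)/(1−α₂))², ((1+β₁)/(1−β₂))²}·B·‖f‖². -/
open MeasureTheory

lemma pert_bounds {K : Type*} [NormedAddCommGroup K] (x y : K) (a b : ℝ)
    (ha : 0 ≤ a) (ha1 : a < 1) (hb : 0 ≤ b) (hb1 : b < 1)
    (h : ‖x - y‖ ≤ a * ‖x‖ + b * ‖y‖) :
    ((1 - a) / (1 + b)) ^ 2 * ‖x‖ ^ 2 ≤ ‖y‖ ^ 2 ∧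
      ‖y‖ ^ 2 ≤ ((1 + a) / (1 - b)) ^ 2 * ‖x‖ ^ 2 := by
  have h1 : ‖x‖ - ‖y‖ ≤ ‖x - y‖ := norm_sub_norm_le x y
  have h2 : ‖y‖ - ‖x‖ ≤ ‖x - y‖ := by
    rw [norm_sub_rev]
    exact norm_sub_norm_le y x
  have hx := norm_nonneg x
  have hy := norm_nonneg y
  have p1 : 0 < 1 + b := by linarith
  have p2 : 0 < 1 - b := by linarith
  have p3 : 0 < 1 - a := by linarith
  constructor
  · rw [← mul_pow]
    apply pow_le_pow_left₀ (by positivity)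
    rw [div_mul_eq_mul_div, div_le_iff₀ p1]
    nlinarith
  · rw [← mul_pow]
    apply pow_le_pow_left₀ hy
    rw [div_mul_eq_mul_div, le_div_iff₀ p2]
    nlinarith

lemma pert_int {𝔄 : Type*} [MeasurableSpace 𝔄] (μ : Measure 𝔄) (J : Set 𝔄) (u v : 𝔄 → ℝ)
    (hu : Integrable u μ) (hv : Integrable v μ) (c : ℝ) (h : ∀ s, c * u s ≤ v s) :
    c * ∫ s in J, u s ∂μ ≤ ∫ s in J, v s ∂μ := by
  rw [← integral_const_mul]
  exact integral_mono (hu.integrableOn.const_mul c) hv.integrableOn h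

lemma pert_int' {𝔄 : Type*} [MeasurableSpace 𝔄] (μ : Measure 𝔄) (J : Set 𝔄) (u v : 𝔄 → ℝ)
    (hu : Integrable u μ) (hv : Integrable v μ) (c : ℝ) (h : ∀ s, v s ≤ c * u s) :
    ∫ s in J, v s ∂μ ≤ c * ∫ s in J, u s ∂μ := by
  rw [← integral_const_mul]
  exact integral_mono hv.integrableOn (hu.integrableOn.const_mul c) h

/-- Perturbations of woven continuous L-g-frames are woven continuous L-g-frames. -/
theorem stmt_17
    {𝔄 : Type*} [MeasurableSpace 𝔄] (μ : Measure 𝔄)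
    {H K : Type*}
    [NormedAddCommGroup H] [InnerProductSpace ℂ H] [CompleteSpace H]
    [NormedAddCommGroup K] [InnerProductSpace ℂ K] [CompleteSpace K]
    (L : H →L[ℂ] H)
    (χ ξ χ' ξ' : 𝔄 → (H →L[ℂ] K))
    (A B : ℝ) (hA : 0 < A) (hAB : A ≤ B)
    (hχint : ∀ f : H, Integrable (fun ς => ‖χ ς f‖ ^ 2) μ)
    (hξint : ∀ f : H, Integrable (fun ς => ‖ξ ς f‖ ^ 2) μ)
    (hwoven : ∀ (J : Set 𝔄), MeasurableSet J → ∀ f : H,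
      A * ‖ContinuousLinearMap.adjoint L f‖ ^ 2 ≤
          (∫ ς in J, ‖χ ς f‖ ^ 2 ∂μ) + ∫ ς in Jᶜ, ‖ξ ς f‖ ^ 2 ∂μ ∧
        (∫ ς in J, ‖χ ς f‖ ^ 2 ∂μ) + ∫ ς in Jᶜ, ‖ξ ς f‖ ^ 2 ∂μ ≤ B * ‖f‖ ^ 2)
    (α₁ α₂ β₁ β₂ : ℝ)
    (hα₁ : 0 ≤ α₁) (hα₁1 : α₁ < 1) (hα₂ : 0 ≤ α₂) (hα₂1 : α₂ < 1)
    (hβ₁ : 0 ≤ β₁) (hβ₁1 : β₁ < 1) (hβ₂ : 0 ≤ β₂) (hβ₂1 : β₂ < 1)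
    (hχ'int : ∀ f : H, Integrable (fun ς => ‖χ' ς f‖ ^ 2) μ)
    (hξ'int : ∀ f : H, Integrable (fun ς => ‖ξ' ς f‖ ^ 2) μ)
    (hpertχ : ∀ (ς : 𝔄) (f : H),
      ‖χ ς f - χ' ς f‖ ≤ α₁ * ‖χ ς f‖ + α₂ * ‖χ' ς f‖)
    (hpertξ : ∀ (ς : 𝔄) (f : H),
      ‖ξ ς f - ξ' ς f‖ ≤ β₁ * ‖ξ ς f‖ + β₂ * ‖ξ' ς f‖) :
    ∀ (J : Set 𝔄), MeasurableSet J → ∀ f : H,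
      min (((1 - α₁) / (1 + α₂)) ^ 2) (((1 - β₁) / (1 + β₂)) ^ 2) * A *
          ‖ContinuousLinearMap.adjoint L f‖ ^ 2 ≤
          (∫ ς in J, ‖χ' ς f‖ ^ 2 ∂μ) + ∫ ς in Jᶜ, ‖ξ' ς f‖ ^ 2 ∂μ ∧
        (∫ ς in J, ‖χ' ς f‖ ^ 2 ∂μ) + ∫ ς in Jᶜ, ‖ξ' ς f‖ ^ 2 ∂μ ≤
          max (((1 + α₁) / (1 - α₂)) ^ 2) (((1 + β₁) / (1 - β₂)) ^ 2) * B * ‖f‖ ^ 2 := by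
  intro J hJ f
  obtain ⟨hl, hr⟩ := hwoven J hJ f
  have bχ := fun s => pert_bounds _ _ α₁ α₂ hα₁ hα₁1 hα₂ hα₂1 (hpertχ s f)
  have bξ := fun s => pert_bounds _ _ β₁ β₂ hβ₁ hβ₁1 hβ₂ hβ₂1 (hpertξ s f)
  have i1 := pert_int μ J _ _ (hχint f) (hχ'int f) _ (fun s => (bχ s).1)
  have i2 := pert_int μ Jᶜ _ _ (hξint f) (hξ'int f) _ (fun s => (bξ s).1)
  have i3 := pert_int' μ J _ _ (hχint f) (hχ'int f) _ (fun s => (bχ s).2)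
  have i4 := pert_int' μ Jᶜ _ _ (hξint f) (hξ'int f) _ (fun s => (bξ s).2)
  have n1 : 0 ≤ ∫ s in J, ‖χ s f‖ ^ 2 ∂μ := integral_nonneg (fun s => sq_nonneg _)
  have n2 : 0 ≤ ∫ s in Jᶜ, ‖ξ s f‖ ^ 2 ∂μ := integral_nonneg (fun s => sq_nonneg _)
  constructor
  · have m0 : 0 ≤ min (((1 - α₁) / (1 + α₂)) ^ 2) (((1 - β₁) / (1 + β₂)) ^ 2) :=
      le_min (sq_nonneg _) (sq_nonneg _)
    have e := mul_le_mul_of_nonneg_left hl m0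
    have e1 := mul_le_mul_of_nonneg_right
      (min_le_left (((1 - α₁) / (1 + α₂)) ^ 2) (((1 - β₁) / (1 + β₂)) ^ 2)) n1
    have e2 := mul_le_mul_of_nonneg_right
      (min_le_right (((1 - α₁) / (1 + α₂)) ^ 2) (((1 - β₁) / (1 + β₂)) ^ 2)) n2
    rw [mul_add] at e
    rw [mul_assoc]
    linarith
  · have m0 : 0 ≤ max (((1 + α₁) / (1 - α₂)) ^ 2) (((1 + β₁) / (1 - β₂)) ^ 2) :=
      le_max_of_le_left (sq_nonneg _)
    have e := mul_le_mul_of_nonneg_left hr m0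
    have e1 := mul_le_mul_of_nonneg_right
      (le_max_left (((1 + α₁) / (1 - α₂)) ^ 2) (((1 + β₁) / (1 - β₂)) ^ 2)) n1
    have e2 := mul_le_mul_of_nonneg_right
      (le_max_right (((1 + α₁) / (1 - α₂)) ^ 2) (((1 + β₁) / (1 - β₂)) ^ 2)) n2
    rw [mul_add] at e
    rw [mul_assoc]
    linarith
end

section
/- Let χ = {χ_ς} and ξ = {ξ_ς} be (A, B)-woven continuous L-g-frames, let m₁, m₂ ≥ 0, and let χ' = {χ'_ς} and ξ' = {ξ'_ς} be families of operators in B(H, K) (with ς ↦ ‖χ'_ς f‖² and ς ↦ ‖ξ'_ς f‖² integrable for each f ∈ H) such that for all f ∈ H and all ς ∈ 𝔄: ‖χ_ς f − χ'_ς f‖ ≤ m₁·min{‖χ_ς f‖, ‖χ'_ς f‖} and ‖ξ_ς f − ξ'_ς f‖ ≤ m₂·min{‖ξ_ς f‖, ‖ξ'_ς f‖}. Then χ' and ξ' are woven continuous L-g-frames: there exist constants 0 < A' ≤ B' < ∞ (one may take A' = A·min{(1+m₁)⁻², (1+m₂)⁻²} and B' = B·max{(1+m₁)², (1+m₂)²})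 such that for every measurable set J ⊆ 𝔄 and every f ∈ H, A'‖L* f‖² ≤ ∫_J ‖χ'_ς f‖² dμ(ς) + ∫_{𝔄∖J} ‖ξ'_ς f‖² dμ(ς) ≤ B'‖f‖². -/
open MeasureTheory

theorem aux_norm {K : Type*} [NormedAddCommGroup K] (u v : K) (m : ℝ) (hm : 0 ≤ m)
    (h : ‖u - v‖ ≤ m * min ‖u‖ ‖v‖) : ‖v‖ ^ 2 ≤ (1 + m) ^ 2 * ‖u‖ ^ 2 := by
  have h1 : m * min ‖u‖ ‖v‖ ≤ m * ‖u‖ := mul_le_mul_of_nonneg_left (min_le_left _ _) hm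
  have h2 : ‖v‖ - ‖u‖ ≤ ‖u - v‖ := by
    rw [norm_sub_rev]; exact norm_sub_norm_le v u
  rw [← mul_pow]
  exact pow_le_pow_left₀ (norm_nonneg v) (by linarith) 2

theorem aux_int {S : Type*} [MeasurableSpace S] (ν : Measure S)
    {K : Type*} [NormedAddCommGroup K] (u v : S → K) (m : ℝ) (hm : 0 ≤ m)
    (hu : Integrable (fun s => ‖u s‖ ^ 2) ν) (hv : Integrable (fun s => ‖v s‖ ^ 2) ν)
    (h : ∀ s, ‖u s - v s‖ ≤ m * min ‖u s‖ ‖v s‖) :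
    ∫ s, ‖v s‖ ^ 2 ∂ν ≤ (1 + m) ^ 2 * ∫ s, ‖u s‖ ^ 2 ∂ν := by
  rw [← integral_const_mul]
  exact integral_mono hv (hu.const_mul _) (fun s => aux_norm _ _ m hm (h s))

theorem aux_int_inv {S : Type*} [MeasurableSpace S] (ν : Measure S)
    {K : Type*} [NormedAddCommGroup K] (u v : S → K) (m : ℝ) (hm : 0 ≤ m)
    (hu : Integrable (fun s => ‖u s‖ ^ 2) ν) (hv : Integrable (fun s => ‖v s‖ ^ 2) ν)
    (h : ∀ s, ‖u s - v s‖ ≤ m * min ‖u s‖ ‖v s‖) :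
    (1 + m)⁻¹ ^ 2 * ∫ s, ‖u s‖ ^ 2 ∂ν ≤ ∫ s, ‖v s‖ ^ 2 ∂ν := by
  have := aux_int ν v u m hm hv hu (fun s => by rw [norm_sub_rev, min_comm]; exact h s)
  rw [inv_pow, inv_mul_le_iff₀ (by positivity)]
  exact this

/-- Families comparable to woven continuous L-g-frames via min-type perturbation bounds
are woven continuous L-g-frames. -/
theorem stmt_19
    {𝔄 : Type*} [MeasurableSpace 𝔄] (μ : Measure 𝔄)
    {H K : Type*}
    [NormedAddCommGroup H] [InnerProductSpace ℂ H] [CompleteSpace H]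
    [NormedAddCommGroup K] [InnerProductSpace ℂ K] [CompleteSpace K]
    (L : H →L[ℂ] H)
    (χ ξ χ' ξ' : 𝔄 → (H →L[ℂ] K))
    (A B : ℝ) (hA : 0 < A) (hAB : A ≤ B)
    (hχint : ∀ f : H, Integrable (fun ς => ‖χ ς f‖ ^ 2) μ)
    (hξint : ∀ f : H, Integrable (fun ς => ‖ξ ς f‖ ^ 2) μ)
    (hwoven : ∀ (J : Set 𝔄), MeasurableSet J → ∀ f : H,
      A * ‖ContinuousLinearMap.adjoint L f‖ ^ 2 ≤
          (∫ ς in J, ‖χ ς f‖ ^ 2 ∂μ) + ∫ ς in Jᶜ, ‖ξ ς f‖ ^ 2 ∂μ ∧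
        (∫ ς in J, ‖χ ς f‖ ^ 2 ∂μ) + ∫ ς in Jᶜ, ‖ξ ς f‖ ^ 2 ∂μ ≤ B * ‖f‖ ^ 2)
    (m₁ m₂ : ℝ) (hm₁ : 0 ≤ m₁) (hm₂ : 0 ≤ m₂)
    (hχ'int : ∀ f : H, Integrable (fun ς => ‖χ' ς f‖ ^ 2) μ)
    (hξ'int : ∀ f : H, Integrable (fun ς => ‖ξ' ς f‖ ^ 2) μ)
    (hpertχ : ∀ (ς : 𝔄) (f : H),
      ‖χ ς f - χ' ς f‖ ≤ m₁ * min ‖χ ς f‖ ‖χ' ς f‖)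
    (hpertξ : ∀ (ς : 𝔄) (f : H),
      ‖ξ ς f - ξ' ς f‖ ≤ m₂ * min ‖ξ ς f‖ ‖ξ' ς f‖) :
    ∃ A' B' : ℝ, 0 < A' ∧ A' ≤ B' ∧
      A' = A * min ((1 + m₁)⁻¹ ^ 2) ((1 + m₂)⁻¹ ^ 2) ∧
      B' = B * max ((1 + m₁) ^ 2) ((1 + m₂) ^ 2) ∧
      ∀ (J : Set 𝔄), MeasurableSet J → ∀ f : H,
        A' * ‖ContinuousLinearMap.adjoint L f‖ ^ 2 ≤
            (∫ ς in J, ‖χ' ς f‖ ^ 2 ∂μ) + ∫ ς in Jᶜ, ‖ξ' ς f‖ ^ 2 ∂μ ∧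
          (∫ ς in J, ‖χ' ς f‖ ^ 2 ∂μ) + ∫ ς in Jᶜ, ‖ξ' ς f‖ ^ 2 ∂μ ≤ B' * ‖f‖ ^ 2 := by
  have hp : 0 < min ((1 + m₁)⁻¹ ^ 2) ((1 + m₂)⁻¹ ^ 2) := by
    apply lt_min <;> positivity
  refine ⟨_, _, mul_pos hA hp, ?_, rfl, rfl, ?_⟩
  · have h1 : (1 + m₁)⁻¹ ^ 2 ≤ 1 :=
      pow_le_one₀ (by positivity) (inv_le_one_of_one_le₀ (by linarith))
    have h2 : 1 ≤ (1 + m₁) ^ 2 := one_le_pow₀ (by linarith)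
    exact mul_le_mul hAB
      ((min_le_left _ _).trans (h1.trans (h2.trans (le_max_left _ _)))) hp.le (by linarith)
  · intro J hJ f
    obtain ⟨hl, hu⟩ := hwoven J hJ f
    have a1 := aux_int (μ.restrict J) (fun s => χ s f) (fun s => χ' s f) m₁ hm₁
      (hχint f).restrict (hχ'int f).restrict (fun s => hpertχ s f)
    have a2 := aux_int (μ.restrict Jᶜ) (fun s => ξ s f) (fun s => ξ' s f) m₂ hm₂
      (hξint f).restrict (hξ'int f).restrict (fun s => hpertξ s f)
    have b1 := aux_int_inv (μ.restrict J) (fun s => χ s f) (fun s => χ' s f) m₁ hm₁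
      (hχint f).restrict (hχ'int f).restrict (fun s => hpertχ s f)
    have b2 := aux_int_inv (μ.restrict Jᶜ) (fun s => ξ s f) (fun s => ξ' s f) m₂ hm₂
      (hξint f).restrict (hξ'int f).restrict (fun s => hpertξ s f)
    have p1 : 0 ≤ ∫ ς in J, ‖χ ς f‖ ^ 2 ∂μ := integral_nonneg (fun s => by positivity)
    have p2 : 0 ≤ ∫ ς in Jᶜ, ‖ξ ς f‖ ^ 2 ∂μ := integral_nonneg (fun s => by positivity)
    have hM : 0 ≤ max ((1 + m₁) ^ 2) ((1 + m₂) ^ 2) := le_max_of_le_left (by positivity)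
    have c1 := mul_le_mul_of_nonneg_right (min_le_left ((1 + m₁)⁻¹ ^ 2) ((1 + m₂)⁻¹ ^ 2)) p1
    have c2 := mul_le_mul_of_nonneg_right (min_le_right ((1 + m₁)⁻¹ ^ 2) ((1 + m₂)⁻¹ ^ 2)) p2
    have d1 := mul_le_mul_of_nonneg_right (le_max_left ((1 + m₁) ^ 2) ((1 + m₂) ^ 2)) p1
    have d2 := mul_le_mul_of_nonneg_right (le_max_right ((1 + m₁) ^ 2) ((1 + m₂) ^ 2)) p2
    have e1 := mul_le_mul_of_nonneg_left hl hp.le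
    have e2 := mul_le_mul_of_nonneg_left hu hM
    constructor <;> linarith
end
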